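/- If X ∈ H₀(Ω) and n > 0, then d_n(X) ∩ Ω ∈ H_n(Ω). -/

import Mathlib

open Ordinal Set Filter

/-- `X` is ultimately periodic in `Ω` with offset length `δ`, period length `π`
and exponent `lam`. -/
def UPWith (X : Set Ordinal) (Ω δ π lam : Ordinal) : Prop :=
  δ < Ω ∧ 0 < π ∧ Order.IsSuccLimit lam ∧ Ω = δ + π * lam ∧
    ∀ γ < lam, ∀ ξ < π, (δ + π * γ + ξ ∈ X ↔ δ + ξ ∈ X)

/-- `X` is ultimately periodic in `Ω` with offset length `δ` and period length `π`. -/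
def UPIn (X : Set Ordinal) (Ω δ π : Ordinal) : Prop := ∃ lam, UPWith X Ω δ π lam

/-- `X` is ultimately periodic in `Ω`. -/
def UP (X : Set Ordinal) (Ω : Ordinal) : Prop := ∃ δ π, UPIn X Ω δ π

/-- `X` is periodic in `Ω` with period length `π`. -/
def PeriodicIn (X : Set Ordinal) (Ω π : Ordinal) : Prop := UPIn X Ω 0 π

/-- `H₀(Ω)`: the family of subsets of `Ω` that are hereditarily periodic in `Ω`. -/
def H0 (Ω : Ordinal) : Set (Set Ordinal) :=
  {X | X ⊆ Set.Iio Ω ∧ ∀ β ≤ Ω, Order.IsSuccLimit β → UP (X ∩ Set.Iio β) β}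

/-- `ℓ(α)`: the last (smallest) exponent in the Cantor normal form of `α`, with `ℓ(0) = 0`. -/
noncomputable def ell (α : Ordinal) : Ordinal :=
  (((Ordinal.CNF Ordinal.omega0 α).getLast?).map Prod.fst).getD 0

/-- The derived-set operator of a topology `t`. -/
def dSet {X : Type*} (t : TopologicalSpace X) (S : Set X) : Set X :=
  {x | @AccPt X t x (Filter.principal S)}

/-- `d₀`: the derived-set operator of the order (interval) topology on the ordinals. -/
noncomputable def d0 : Set Ordinal → Set Ordinal := dSet inferInstance

/-- Icard's topology `ϑ_n` on the ordinals. -/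
noncomputable def icard (n : ℕ) : TopologicalSpace Ordinal :=
  TopologicalSpace.generateFrom
    ({U | IsOpen U} ∪
      {U | ∃ m : ℕ, 1 ≤ m ∧ m ≤ n ∧ ∃ β : Ordinal, U = {α | β < ell^[m] α}})

/-- `d_n`: the derived-set operator of Icard's topology `ϑ_n`. -/
noncomputable def dIcard (n : ℕ) : Set Ordinal → Set Ordinal := dSet (icard n)

/-- The base family `V_n(Ω)` of `n`-periodic subsets of `Ω`. -/
def Vn : ℕ → Ordinal → Set (Set Ordinal)
  | 0, Ω => H0 Ω
  | (n+1), Ω => {S | ∃ B ∈ H0 Ω, ∃ A ∈ Vn n Ω, S = B ∩ {α | α < Ω ∧ ell α ∈ A}}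

/-- `H_n(Ω)`: finite unions of members of `V_n(Ω)`, the `n`-periodic subsets of `Ω`. -/
def Hn (n : ℕ) (Ω : Ordinal) : Set (Set Ordinal) :=
  {S | ∃ F : Finset (Set Ordinal), ↑F ⊆ Vn n Ω ∧ S = ⋃₀ ↑F}


theorem ell_zero : ell 0 = 0 := by simp [ell]

theorem ell_rec {α : Ordinal} (h : α ≠ 0) :
    ell α = if α % ω ^ log ω α = 0 then log ω α else ell (α % ω ^ log ω α) := by
  unfold ell
  rw [CNF.ne_zero h]
  split_ifs with h1
  · simp [h1]
  · rw [CNF.ne_zero h1]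
    simp [List.getLast?_cons]

theorem opow_dvd_opow_of_le {a b : Ordinal} (h : a ≤ b) : (ω : Ordinal) ^ a ∣ ω ^ b :=
  opow_dvd_opow _ h

theorem log_lt_not_dvd {q α : Ordinal} (h : α ≠ 0) (hq : α < ω ^ q) : ¬ ω ^ q ∣ α := by
  intro hd
  exact absurd (le_of_dvd h hd) (not_le.2 hq)

theorem le_ell_iff {α : Ordinal} (h : α ≠ 0) (q : Ordinal) : q ≤ ell α ↔ ω ^ q ∣ α := by
  induction α using CNF.rec ω with
  | H0 => exact absurd rfl h
  | H α hα ih =>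
    rw [ell_rec hα]
    have hdm := Ordinal.div_add_mod α (ω ^ log ω α)
    have hlt : α < ω ^ Order.succ (log ω α) := lt_opow_succ_log_self one_lt_omega0 α
    split_ifs with h1
    · constructor
      · intro hq
        rw [h1, add_zero] at hdm
        rw [← hdm]
        exact Dvd.dvd.mul_right (opow_dvd_opow _ hq) _
      · intro hd
        by_contra hq
        push Not at hq
        refine log_lt_not_dvd hα (hlt.trans_le ?_) hd
        exact opow_le_opow_right omega0_pos (Order.succ_le_of_lt hq)
    · rw [ih h1]
      have hmod : α % ω ^ log ω α < ω ^ log ω α := Ordinal.mod_lt _ (opow_ne_zero _ omega0_ne_zero)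
      by_cases hq : q ≤ log ω α
      · have : ω ^ q ∣ ω ^ log ω α * (α / ω ^ log ω α) := Dvd.dvd.mul_right (opow_dvd_opow _ hq) _
        conv_rhs => rw [← hdm]
        rw [dvd_add_iff this]
      · push Not at hq
        constructor
        · intro hd
          exact absurd hd (log_lt_not_dvd h1 (hmod.trans_le (opow_le_opow_right omega0_pos hq.le)))
        · intro hd
          exact absurd hd (log_lt_not_dvd hα (hlt.trans_le
            (opow_le_opow_right omega0_pos (Order.succ_le_of_lt hq))))

theorem ell_add (a : Ordinal) {x : Ordinal} (hx : x ≠ 0) : ell (a + x) = ell x := by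
  have h0 : a + x ≠ 0 := by simp [hx]
  refine eq_of_forall_le_iff fun q => ?_
  rw [le_ell_iff h0, le_ell_iff hx]
  have hdm := Ordinal.div_add_mod a (ω ^ q)
  have hr : a % ω ^ q < ω ^ q := Ordinal.mod_lt _ (opow_ne_zero _ omega0_ne_zero)
  rw [← hdm, add_assoc, dvd_add_iff (dvd_mul_right _ _)]
  by_cases hq : ω ^ q ≤ x
  · rw [add_of_omega0_opow_le hr hq]
  · push Not at hq
    constructor
    · intro hd
      exact absurd hd (log_lt_not_dvd (by simp [hx]) (isPrincipal_add_omega0_opow q hr hq))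
    · intro hd
      exact absurd hd (log_lt_not_dvd hx hq)

theorem ell_opow (q : Ordinal) : ell (ω ^ q) = q := by
  refine eq_of_forall_le_iff fun p => ?_
  rw [le_ell_iff (opow_ne_zero _ omega0_ne_zero), opow_dvd_opow_iff one_lt_omega0]

theorem ell_le (α : Ordinal) : ell α ≤ α := by
  by_cases h : α = 0
  · simp [h, ell_zero]
  · have := le_of_dvd h ((le_ell_iff h _).1 le_rfl)
    exact (right_le_opow _ one_lt_omega0).trans this

theorem ell_pos_iff {α : Ordinal} : 0 < ell α ↔ Order.IsSuccLimit α := by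
  by_cases h : α = 0
  · subst h; simp [ell_zero]
  · rw [← Order.one_le_iff_pos, le_ell_iff h, opow_one, isSuccLimit_iff,
      isSuccPrelimit_iff_omega0_dvd]
    simp [h]

/-- Splitting off the last term of the Cantor normal form. -/
theorem ell_decomp {α : Ordinal} (h : α ≠ 0) : ∃ a, α = a + ω ^ ell α := by
  obtain ⟨μ, hμ⟩ := (le_ell_iff h _).1 le_rfl
  rcases zero_or_succ_or_isSuccLimit μ with rfl | ⟨ν, rfl⟩ | hl
  · simp at hμ; exact absurd hμ h
  · refine ⟨ω ^ ell α * ν, ?_⟩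
    rw [mul_succ] at hμ
    exact hμ
  · exfalso
    obtain ⟨ν, rfl⟩ := isSuccPrelimit_iff_omega0_dvd.1 hl.isSuccPrelimit
    rw [← mul_assoc, ← opow_succ] at hμ
    have : Order.succ (ell α) ≤ ell α := (le_ell_iff h _).2 ⟨ν, hμ⟩
    exact absurd this (not_le.2 (Order.lt_succ _))

theorem mul_omega0_eq_opow {π : Ordinal} (h : 0 < π) : π * ω = ω ^ Order.succ (log ω π) := by
  apply le_antisymm
  · rw [mul_le_iff_of_isSuccLimit isSuccLimit_omega0]
    intro b hb
    exact (mul_lt_omega0_opow (by simp) (lt_opow_succ_log_self one_lt_omega0 π) hb).le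
  · rw [opow_succ]
    exact mul_le_mul_left (opow_log_le_self ω (ne_of_gt h)) ω

/-- The point between. -/
theorem exists_add_form {a y z : Ordinal} (h1 : a ≤ y) (h2 : y < a + z) : ∃ x, y = a + x ∧ x < z := by
  refine ⟨y - a, (Ordinal.add_sub_cancel_of_le h1).symm, ?_⟩
  rw [← Ordinal.add_sub_cancel_of_le h1] at h2
  exact lt_of_add_lt_add_left h2

theorem ell_lt_of_mem {a q y : Ordinal} (h1 : a < y) (h2 : y < a + ω ^ q) : ell y < q := by
  obtain ⟨x, rfl, hx⟩ := exists_add_form h1.le h2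
  have hx0 : x ≠ 0 := by rintro rfl; simp at h1
  rw [ell_add _ hx0]
  by_contra hq
  push Not at hq
  exact log_lt_not_dvd hx0 hx ((le_ell_iff hx0 _).1 hq)

theorem UPWith.lt {X : Set Ordinal} {β δ π lam : Ordinal} (h : UPWith X β δ π lam)
    {γ ξ : Ordinal} (hγ : γ < lam) (hξ : ξ < π) : δ + π * γ + ξ < β := by
  obtain ⟨_, hπ, hl, rfl, _⟩ := h
  calc δ + π * γ + ξ < δ + π * γ + π := by gcongr
    _ = δ + π * Order.succ γ := by rw [mul_succ, add_assoc]
    _ ≤ δ + π * lam := by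
      gcongr
      exact Order.succ_le_of_lt hγ

theorem upWith_inter_iff {X : Set Ordinal} {β δ π lam : Ordinal} :
    UPWith (X ∩ Set.Iio β) β δ π lam ↔ UPWith X β δ π lam := by
  have key : ∀ Y Z : Set Ordinal, (∀ x < β, x ∈ Y ↔ x ∈ Z) →
      UPWith Y β δ π lam → UPWith Z β δ π lam := by
    intro Y Z hYZ h
    obtain ⟨h1, h2, h3, h4, h5⟩ := id h
    refine ⟨h1, h2, h3, h4, fun γ hγ ξ hξ => ?_⟩
    have e1 := h.lt hγ hξ
    have e2 := h.lt h3.bot_lt hξ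
    simp only [Ordinal.bot_eq_zero, mul_zero, add_zero] at e2
    rw [← hYZ _ e1, ← hYZ _ e2]
    exact h5 γ hγ ξ hξ
  constructor
  · exact key _ _ fun x hx => by simp [hx]
  · exact key _ _ fun x hx => by simp [hx]

theorem up_inter_iff {X : Set Ordinal} {β : Ordinal} : UP (X ∩ Set.Iio β) β ↔ UP X β := by
  simp only [UP, UPIn, upWith_inter_iff]

/-- Moving the offset. -/
theorem UPWith.shift {X : Set Ordinal} {β δ π μ lam : Ordinal} (h : UPWith X β δ π (μ + lam))
    (hl : Order.IsSuccLimit lam) : UPWith X β (δ + π * μ) π lam := by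
  obtain ⟨h1, h2, h3, h4, h5⟩ := h
  have h6 : β = δ + π * μ + π * lam := by rw [h4, mul_add, add_assoc]
  refine ⟨?_, h2, hl, h6, fun γ hγ ξ hξ => ?_⟩
  · rw [h6]
    have : 0 < π * lam := Left.mul_pos h2 hl.bot_lt
    exact lt_add_of_pos_right _ this
  · have e1 := h5 (μ + γ) (by gcongr) ξ hξ
    have e2 := h5 μ (lt_add_of_pos_right _ hl.bot_lt) ξ hξ
    rw [mul_add, ← add_assoc] at e1
    rw [e1, e2]

/-- Multiplying the period by `ω`. -/
theorem UPWith.mul_omega {X : Set Ordinal} {β δ π μ : Ordinal} (h : UPWith X β δ π (ω * μ))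
    (hl : Order.IsSuccLimit μ) : UPWith X β δ (π * ω) μ := by
  obtain ⟨h1, h2, h3, h4, h5⟩ := h
  refine ⟨h1, Left.mul_pos h2 omega0_pos, hl, by rw [h4, mul_assoc], fun γ hγ ξ hξ => ?_⟩
  obtain ⟨k, hk, r, hr, rfl⟩ := lt_mul_iff.1 hξ
  have e1 := h5 (ω * γ + k) ?_ r hr
  · have e2 := h5 k ?_ r hr
    · rw [mul_add, ← add_assoc, ← mul_assoc] at e1
      rw [← add_assoc, ← add_assoc, e1, e2]
    · exact hk.trans_le (le_mul_left _ hl.bot_lt)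
  · calc ω * γ + k < ω * γ + ω := by gcongr
      _ = ω * Order.succ γ := by rw [mul_succ]
      _ ≤ ω * μ := by
        gcongr
        exact Order.succ_le_of_lt hγ

theorem UPWith.split {X : Set Ordinal} {β δ π lam : Ordinal} (h : UPWith X β δ π lam) :
    (∃ δ', UPWith X β δ' π ω) ∨ ∃ μ, Order.IsSuccLimit μ ∧ lam = ω * μ := by
  have hl := h.2.2.1
  obtain ⟨μ, rfl⟩ := isSuccPrelimit_iff_omega0_dvd.1 hl.isSuccPrelimit
  rcases zero_or_succ_or_isSuccLimit μ with rfl | ⟨ν, rfl⟩ | hμ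
  · simp at hl
  · left
    rw [mul_succ] at h
    exact ⟨_, h.shift isSuccLimit_omega0⟩
  · exact Or.inr ⟨μ, hμ, rfl⟩

theorem UP.cases {X : Set Ordinal} {β : Ordinal} (h : UP X β) :
    (∃ δ π, UPWith X β δ π ω) ∨
      ∃ δ q ν : Ordinal, Order.IsSuccLimit ν ∧ UPWith X β δ (ω ^ q) (ω * ν) := by
  obtain ⟨δ, π, lam, h⟩ := h
  rcases h.split with ⟨δ', h'⟩ | ⟨μ, hμ, rfl⟩
  · exact Or.inl ⟨_, _, h'⟩
  have h2 := h.mul_omega hμ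
  rw [mul_omega0_eq_opow h.2.1] at h2
  rcases h2.split with ⟨δ', h'⟩ | ⟨ν, hν, rfl⟩
  · exact Or.inl ⟨_, _, h'⟩
  · exact Or.inr ⟨_, _, ν, hν, h2⟩

/-- The auxiliary set. -/
def E0 (X : Set Ordinal) : Set Ordinal :=
  {α | ∀ p < ell α, ∀ γ < α, ∃ η ∈ X, γ < η ∧ η < α ∧ p ≤ ell η}

theorem E0_translate_aux {X : Set Ordinal} {a b ξ : Ordinal} (hξ : 0 < ξ)
    (h : ∀ x, 0 < x → x < ξ → (a + x ∈ X ↔ b + x ∈ X)) (ha : a + ξ ∈ E0 X) : b + ξ ∈ E0 X := by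
  intro p hp γ hγ
  rw [ell_add _ hξ.ne'] at hp
  obtain ⟨x0, hx0, hγx⟩ := (lt_add_iff hξ.ne').1 hγ
  obtain ⟨η, hη, h1, h2, h3⟩ := ha p (by rwa [ell_add _ hξ.ne']) (a + x0) (by gcongr)
  obtain ⟨x, rfl, hx⟩ := exists_add_form (le_self_add.trans h1.le) h2
  have hx0x : x0 < x := lt_of_add_lt_add_left h1
  have hxp : 0 < x := bot_le.trans_lt hx0x
  refine ⟨b + x, (h x hxp hx).1 hη, hγx.trans_lt (by gcongr), by gcongr, ?_⟩
  rwa [ell_add _ hxp.ne'] at h3 ⊢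

theorem E0_translate {X : Set Ordinal} {a b ξ : Ordinal} (hξ : 0 < ξ)
    (h : ∀ x, 0 < x → x < ξ → (a + x ∈ X ↔ b + x ∈ X)) : a + ξ ∈ E0 X ↔ b + ξ ∈ E0 X :=
  ⟨E0_translate_aux hξ h, E0_translate_aux hξ fun x h1 h2 => (h x h1 h2).symm⟩

theorem UPWith.mem_iff_of_le_ell {X : Set Ordinal} {α δ q lam η : Ordinal}
    (h : UPWith X α δ (ω ^ q) lam) (h1 : δ < η) (h2 : η < α) (h3 : q ≤ ell η) :
    η ∈ X ↔ δ ∈ X := by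
  obtain ⟨_, hπ, hl, rfl, h5⟩ := h
  obtain ⟨x, rfl, hx⟩ := exists_add_form h1.le h2
  have hx0 : x ≠ 0 := by rintro rfl; simp at h1
  rw [ell_add _ hx0, le_ell_iff hx0] at h3
  obtain ⟨γ, rfl⟩ := h3
  have := h5 γ (lt_of_mul_lt_mul_left' hx) 0 hπ
  simpa using this

theorem UPWith.lt_ell {X : Set Ordinal} {α δ q lam : Ordinal}
    (h : UPWith X α δ (ω ^ q) lam) : q < ell α := by
  obtain ⟨_, hπ, hl, rfl, h5⟩ := h
  have h0 : ω ^ q * lam ≠ 0 := (Left.mul_pos hπ hl.bot_lt).ne'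
  rw [ell_add _ h0, ← Order.succ_le_iff, le_ell_iff h0]
  obtain ⟨μ, rfl⟩ := isSuccPrelimit_iff_omega0_dvd.1 hl.isSuccPrelimit
  rw [opow_succ, ← mul_assoc]
  exact dvd_mul_right _ _

theorem exists_between_ell {α p γ : Ordinal} (hp : p < ell α) (hγ : γ < α) :
    ∃ η, γ < η ∧ η < α ∧ ell η = p := by
  have h0 : α ≠ 0 := (bot_le.trans_lt hγ).ne'
  obtain ⟨a, ha⟩ := ell_decomp h0
  have hpos : (0 : Ordinal) < ω ^ p := opow_pos _ omega0_pos
  have hm : max γ a < a + ω ^ ell α := by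
    rw [← ha]
    refine max_lt hγ ?_
    conv_rhs => rw [ha]
    exact lt_add_of_pos_right _ (opow_pos _ omega0_pos)
  obtain ⟨x, hx, hxl⟩ := exists_add_form (le_max_right γ a) hm
  refine ⟨max γ a + ω ^ p, (le_max_left γ a).trans_lt (lt_add_of_pos_right _ hpos), ?_, ?_⟩
  · rw [hx, add_assoc]
    conv_rhs => rw [ha]
    gcongr
    exact isPrincipal_add_omega0_opow _ hxl ((opow_lt_opow_iff_right one_lt_omega0).2 hp)
  · rw [ell_add _ hpos.ne', ell_opow]

theorem UPWith.mem_E0_iff {X : Set Ordinal} {α δ q lam : Ordinal}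
    (h : UPWith X α δ (ω ^ q) lam) : α ∈ E0 X ↔ δ ∈ X := by
  constructor
  · intro hα
    obtain ⟨η, hη, h1, h2, h3⟩ := hα q h.lt_ell δ h.1
    exact (h.mem_iff_of_le_ell h1 h2 h3).1 hη
  · intro hδ p hp γ hγ
    obtain ⟨η, h1, h2, h3⟩ := exists_between_ell (max_lt hp h.lt_ell) (max_lt hγ h.1)
    refine ⟨η, ?_, (le_max_left _ _).trans_lt h1, h2, h3 ▸ le_max_left _ _⟩
    exact (h.mem_iff_of_le_ell ((le_max_right _ _).trans_lt h1) h2 (h3 ▸ le_max_right _ _)).2 hδ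

theorem UPWith.restrict {X : Set Ordinal} {β δ π lam μ : Ordinal} (h : UPWith X β δ π lam)
    (hμ : Order.IsSuccLimit μ) (hle : μ ≤ lam) : UPWith X (δ + π * μ) δ π μ := by
  obtain ⟨h1, h2, h3, h4, h5⟩ := h
  exact ⟨lt_add_of_pos_right _ (Left.mul_pos h2 hμ.bot_lt), h2, hμ, rfl,
    fun γ hγ => h5 γ (hγ.trans_le hle)⟩

/-- Translating for positive remainder. -/
theorem UPWith.E0_pos {X : Set Ordinal} {β δ π lam : Ordinal} (h : UPWith X β δ π lam)
    {γ ξ : Ordinal} (hγ : γ < lam) (hξ0 : 0 < ξ) (hξ : ξ ≤ π) :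
    δ + π * γ + ξ ∈ E0 X ↔ δ + ξ ∈ E0 X :=
  E0_translate hξ0 fun x _ hx => h.2.2.2.2 γ hγ x (hx.trans_le hξ)

theorem UP.E0 {X : Set Ordinal} {β : Ordinal} (h : UP X β) : UP (E0 X) β := by
  rcases h.cases with ⟨δ, π, h⟩ | ⟨δ, q, ν, hν, h⟩
  · refine ⟨δ + π, π, ω, ?_⟩
    have hω : (1 : Ordinal) + ω = ω := one_add_omega0
    have h' := h
    rw [← hω] at h'
    obtain ⟨h1, h2, h3, h4, h5⟩ := h'.shift isSuccLimit_omega0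
    rw [mul_one] at h1 h4
    refine ⟨h1, h2, h3, h4, fun γ hγ ξ hξ => ?_⟩
    rcases eq_or_ne ξ 0 with rfl | hξ0
    · rw [add_zero, add_zero, ← h.E0_pos hγ h2 le_rfl]
      obtain ⟨n, rfl⟩ := lt_omega0.1 hγ
      rw [add_assoc, add_assoc]
      have : π + π * (n : Ordinal) = π * n + π := by
        have : (1 : Ordinal) + n = n + 1 := by exact_mod_cast add_comm 1 n
        rw [← mul_one_add, this, mul_add_one]
      rw [this]
    · have e1 := h.E0_pos (γ := 1 + γ) ?_ (pos_iff_ne_zero.2 hξ0) hξ.le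
      · have e2 := h.E0_pos (γ := 1) one_lt_omega0 (pos_iff_ne_zero.2 hξ0) hξ.le
        rw [mul_add, mul_one, ← add_assoc] at e1
        rw [mul_one] at e2
        rw [e1, e2]
      · rw [← hω]; gcongr
  · have g := h.mul_omega hν
    have hων : (1 : Ordinal) + ν = ν := one_add_of_omega0_le (omega0_le_of_isSuccLimit hν)
    have g' := g
    rw [← hων] at g'
    obtain ⟨h1, h2, h3, h4, h5⟩ := g'.shift hν
    refine ⟨_, _, _, h1, h2, h3, h4, fun γ hγ ξ hξ => ?_⟩
    have hγ1 : 1 + γ < ν := by rw [← hων]; gcongr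
    have h1ν : 1 < ν := one_lt_of_isSuccLimit hν
    rw [add_assoc δ, ← mul_add]
    rcases eq_or_ne ξ 0 with rfl | hξ0
    · rw [add_zero, add_zero]
      have key : ∀ μ, 0 < μ → μ < ν → (δ + ω ^ q * ω * μ ∈ _root_.E0 X ↔ δ ∈ X) := by
        intro μ hμ0 hμ
        rw [mul_assoc]
        exact (h.restrict (isSuccLimit_mul_left isSuccLimit_omega0 hμ0)
          (by gcongr)).mem_E0_iff
      rw [key _ (zero_lt_one.trans_le le_self_add) hγ1, key _ zero_lt_one h1ν]
    · rw [g.E0_pos hγ1 (pos_iff_ne_zero.2 hξ0) hξ.le, g.E0_pos h1ν (pos_iff_ne_zero.2 hξ0) hξ.le]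

theorem E0_mem_H0 {X : Set Ordinal} {Ω : Ordinal} (hX : X ∈ H0 Ω) : E0 X ∩ Set.Iio Ω ∈ H0 Ω := by
  refine ⟨Set.inter_subset_right, fun β hβ hl => ?_⟩
  have := (up_inter_iff.1 (hX.2 β hβ hl)).E0
  rw [Set.inter_assoc, Set.Iio_inter_Iio, min_eq_right hβ]
  exact up_inter_iff.2 this

theorem compl_mem_H0 {X : Set Ordinal} {Ω : Ordinal} (hX : X ∈ H0 Ω) :
    Xᶜ ∩ Set.Iio Ω ∈ H0 Ω := by
  refine ⟨Set.inter_subset_right, fun β hβ hl => ?_⟩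
  rw [Set.inter_assoc, Set.Iio_inter_Iio, min_eq_right hβ]
  obtain ⟨δ, π, lam, h1, h2, h3, h4, h5⟩ := up_inter_iff.1 (hX.2 β hβ hl)
  exact up_inter_iff.2 ⟨δ, π, lam, h1, h2, h3, h4, fun γ hγ ξ hξ => not_congr (h5 γ hγ ξ hξ)⟩

theorem empty_mem_H0 (Ω : Ordinal) : ∅ ∈ H0 Ω := by
  refine ⟨Set.empty_subset _, fun β hβ hl => up_inter_iff.2 ⟨0, 1, β, ?_⟩⟩
  exact ⟨hl.bot_lt, zero_lt_one, hl, by simp, by simp⟩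

theorem Iio_mem_H0 (Ω : Ordinal) : Set.Iio Ω ∈ H0 Ω := by
  simpa using compl_mem_H0 (empty_mem_H0 Ω)

theorem ell_pos_mem_H0 (Ω : Ordinal) : {α | α < Ω ∧ 0 < ell α} ∈ H0 Ω := by
  have := compl_mem_H0 (E0_mem_H0 (empty_mem_H0 Ω))
  convert this using 1
  ext α
  simp only [Set.mem_ofPred_eq, Set.mem_inter_iff, Set.mem_compl_iff, Set.mem_Iio, not_and]
  constructor
  · rintro ⟨h1, h2⟩
    refine ⟨fun h _ => ?_, h1⟩
    obtain ⟨η, hη, _⟩ := h 0 h2 0 (h2.trans_le (ell_le α))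
    exact hη
  · rintro ⟨h1, h2⟩
    refine ⟨h2, ?_⟩
    by_contra h
    refine h1 (fun p hp => ?_) h2
    exact absurd (bot_le.trans_lt hp) h

theorem iter_mem_Vn (Ω : Ordinal) (k : ℕ) : {α | α < Ω ∧ 0 < ell^[k + 1] α} ∈ Vn k Ω := by
  induction k with
  | zero => exact ell_pos_mem_H0 Ω
  | succ k ih =>
    refine ⟨_, Iio_mem_H0 Ω, _, ih, ?_⟩
    ext α
    simp only [Set.mem_ofPred_eq, Set.mem_inter_iff, Set.mem_Iio]
    rw [Function.iterate_succ_apply]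
    constructor
    · rintro ⟨h1, h2⟩
      exact ⟨h1, h1, (ell_le α).trans_lt h1, h2⟩
    · rintro ⟨h1, _, _, h2⟩
      exact ⟨h1, h2⟩

open scoped Topology

theorem iter_ell_zero (k : ℕ) : ell^[k] 0 = 0 := by
  induction k with
  | zero => rfl
  | succ k ih => rw [Function.iterate_succ_apply, ell_zero, ih]

theorem iter_pos_ne {k : ℕ} {α : Ordinal} (h : 0 < ell^[k] α) : α ≠ 0 := by
  rintro rfl
  rw [iter_ell_zero] at h
  exact lt_irrefl _ h

theorem exists_filter (n : ℕ) : ∀ α : Ordinal, 0 < ell^[n + 1] α →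
    ∃ G : Filter Ordinal, G.NeBot ∧ (∀ᶠ η in G, η < α) ∧
      ∀ m ≤ n, ∀ β < ell^[m] α, ∀ᶠ η in G, β < ell^[m] η := by
  induction n with
  | zero =>
    intro α hα
    have hl : Order.IsSuccLimit α := ell_pos_iff.1 hα
    refine ⟨⨅ γ : Set.Iio α, 𝓟 (Set.Ioo γ.1 α), ?_, ?_, ?_⟩
    · have : Nonempty (Set.Iio α) := ⟨⟨0, hl.bot_lt⟩⟩
      refine iInf_neBot_of_directed ?_ ?_
      · rintro ⟨a, ha⟩ ⟨b, hb⟩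
        refine ⟨⟨max a b, Set.mem_Iio.2 (max_lt ha hb)⟩, ?_, ?_⟩
        · exact principal_mono.2 (Set.Ioo_subset_Ioo_left (le_max_left _ _))
        · exact principal_mono.2 (Set.Ioo_subset_Ioo_left (le_max_right _ _))
      · rintro ⟨a, ha⟩
        exact principal_neBot_iff.2 ⟨Order.succ a, Order.lt_succ a, hl.succ_lt ha⟩
    · exact mem_iInf_of_mem ⟨0, hl.bot_lt⟩ (mem_principal.2 fun x hx => hx.2)
    · intro m hm β hβ
      obtain rfl : m = 0 := by omega
      exact mem_iInf_of_mem ⟨β, hβ⟩ (mem_principal.2 fun x hx => hx.1)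
  | succ n ih =>
    intro α hα
    rw [Function.iterate_succ_apply] at hα
    obtain ⟨G, hG, h1, h2⟩ := ih (ell α) hα
    have h0 : ell α ≠ 0 := iter_pos_ne hα
    have hα0 : α ≠ 0 := by rintro rfl; exact h0 ell_zero
    have hl : Order.IsSuccLimit (ell α) := by
      rw [← ell_pos_iff, pos_iff_ne_zero]
      rw [Function.iterate_succ_apply] at hα
      exact iter_pos_ne hα
    obtain ⟨a, ha⟩ := ell_decomp hα0
    have hpos : ∀ σ : Ordinal, (0 : Ordinal) < ω ^ σ := fun σ => opow_pos _ omega0_pos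
    refine ⟨G.map fun σ => a + ω ^ σ, hG.map _, ?_, ?_⟩
    · rw [eventually_map]
      filter_upwards [h1] with σ hσ
      conv_rhs => rw [ha]
      gcongr
      exact (opow_lt_opow_iff_right one_lt_omega0).2 hσ
    · intro m hm β hβ
      rw [eventually_map]
      cases m with
      | zero =>
        simp only [Function.iterate_zero, id] at hβ ⊢
        rw [ha, lt_add_iff (hpos _).ne'] at hβ
        obtain ⟨d, hd, hβd⟩ := hβ
        obtain ⟨τ, hτ, hdτ⟩ := (lt_opow_of_isSuccLimit omega0_ne_zero hl).1 hd
        filter_upwards [h2 0 (Nat.zero_le _) τ hτ] with σ hσ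
        refine hβd.trans_lt ?_
        gcongr
        exact hdτ.trans_le (opow_le_opow_right omega0_pos (le_of_lt hσ))
      | succ m =>
        rw [Function.iterate_succ_apply] at hβ
        filter_upwards [h2 m (by omega) β hβ] with σ hσ
        rw [Function.iterate_succ_apply, ell_add _ (hpos _).ne', ell_opow]
        exact hσ

theorem icard_isOpen_of_isOpen (n : ℕ) {U : Set Ordinal} (h : IsOpen U) : IsOpen[icard n] U :=
  TopologicalSpace.isOpen_generateFrom_of_mem (Or.inl h)

theorem icard_isOpen_lt {n m : ℕ} (h1 : 1 ≤ m) (h2 : m ≤ n) (β : Ordinal) :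
    IsOpen[icard n] {α | β < ell^[m] α} :=
  TopologicalSpace.isOpen_generateFrom_of_mem (Or.inr ⟨m, h1, h2, β, rfl⟩)

theorem isOpen_Ioc_ord (a b : Ordinal) : IsOpen (Set.Ioc a b) := by
  have : Set.Ioc a b = Set.Ioo a (Order.succ b) := by
    ext x; simp
  rw [this]
  exact isOpen_Ioo

theorem isOpen_ell_lt (b : Ordinal) : IsOpen (ell ⁻¹' Set.Iio b) := by
  rw [isOpen_iff_mem_nhds]
  intro α hα
  have hα' : ell α < b := hα
  by_cases h0 : α = 0
  · subst h0
    have : IsOpen (Set.Iio (1 : Ordinal)) := isOpen_Iio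
    refine Filter.mem_of_superset (this.mem_nhds (Set.mem_Iio.2 zero_lt_one)) fun x hx => ?_
    obtain rfl : x = 0 := Order.lt_one_iff.1 hx
    exact hα
  · obtain ⟨a, ha⟩ := ell_decomp h0
    have haα : a < α := by
      conv_rhs => rw [ha]
      exact lt_add_of_pos_right _ (opow_pos _ omega0_pos)
    refine Filter.mem_of_superset ((isOpen_Ioc_ord a α).mem_nhds ⟨haα, le_rfl⟩) fun x hx => ?_
    rcases hx.2.lt_or_eq with hx2 | rfl
    · rw [ha] at hx2
      exact (ell_lt_of_mem hx.1 hx2).trans hα'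
    · exact hα

theorem continuous_ell (n : ℕ) : @Continuous _ _ (icard (n + 1)) (icard n) ell := by
  refine (continuous_generateFrom_iff (t := icard (n + 1))).2 ?_
  rintro U (hU | ⟨m, h1, h2, β, rfl⟩)
  · have hU' : IsOpen U := hU
    have hc : @Continuous _ _ (icard (n + 1)) inferInstance ell := by
      refine (@OrderTopology.continuous_iff _ _ _ _ _ (icard (n + 1)) _).2 fun a => ⟨?_, ?_⟩
      · exact icard_isOpen_lt le_rfl (by omega : 1 ≤ n + 1) a
      · exact icard_isOpen_of_isOpen _ (isOpen_ell_lt a)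
    exact @IsOpen.preimage _ _ (icard (n + 1)) _ _ hc _ hU'
  · exact icard_isOpen_lt (m := m + 1) (by omega) (by omega) β

theorem icard_isolated (n : ℕ) : ∀ α : Ordinal, ell^[n + 1] α = 0 → IsOpen[icard n] {α} := by
  induction n with
  | zero =>
    intro α hα
    apply icard_isOpen_of_isOpen
    have hl : ¬ Order.IsSuccLimit α := by
      rw [← ell_pos_iff, not_lt]
      exact hα.le
    rcases zero_or_succ_or_isSuccLimit α with rfl | ⟨b, rfl⟩ | h
    · have : ({0} : Set Ordinal) = Set.Iio 1 := by
        ext x; simp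
      rw [this]; exact isOpen_Iio
    · have : ({Order.succ b} : Set Ordinal) = Set.Ioc b (Order.succ b) := by
        ext x
        simp only [Set.mem_singleton_iff, Set.mem_Ioc]
        constructor
        · rintro rfl; exact ⟨Order.lt_succ b, le_rfl⟩
        · rintro ⟨h1, h2⟩; exact le_antisymm h2 (Order.succ_le_of_lt h1)
      rw [this]; exact isOpen_Ioc_ord _ _
    · exact absurd h hl
  | succ n ih =>
    intro α hα
    by_cases h0 : α = 0
    · subst h0
      apply icard_isOpen_of_isOpen
      have : ({0} : Set Ordinal) = Set.Iio 1 := by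
        ext x; simp
      rw [this]; exact isOpen_Iio
    · rw [Function.iterate_succ_apply] at hα
      have h1 := @IsOpen.preimage _ _ (icard (n + 1)) (icard n) _ (continuous_ell n) _ (ih _ hα)
      obtain ⟨a, ha⟩ := ell_decomp h0
      have haα : a < α := by
        conv_rhs => rw [ha]
        exact lt_add_of_pos_right _ (opow_pos _ omega0_pos)
      have h2 := icard_isOpen_of_isOpen (n + 1) (isOpen_Ioc_ord a α)
      have h3 : IsOpen[icard (n + 1)] (ell ⁻¹' {ell α} ∩ Set.Ioc a α) := (icard (n + 1)).isOpen_inter _ _ h1 h2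
      convert h3 using 1
      ext x
      simp only [Set.mem_singleton_iff, Set.mem_inter_iff, Set.mem_preimage, Set.mem_Ioc]
      constructor
      · rintro rfl; exact ⟨rfl, haα, le_rfl⟩
      · rintro ⟨e1, e2, e3⟩
        by_contra hne
        have hlt := lt_of_le_of_ne e3 hne
        rw [ha] at hlt
        exact absurd e1 (ell_lt_of_mem e2 hlt).ne

theorem dIcard_exists {n : ℕ} {X U : Set Ordinal} {α : Ordinal} (h : α ∈ dIcard n X)
    (hU : IsOpen[icard n] U) (hα : α ∈ U) : ∃ y ∈ U ∩ X, y ≠ α := by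
  have h' : @AccPt Ordinal (icard n) α (𝓟 X) := h
  exact (@accPt_iff_nhds _ (icard n) _ _).1 h' U ((@IsOpen.mem_nhds_iff _ (icard n) _ _ hU).2 hα)

theorem dIcard_iter_pos {n : ℕ} {X : Set Ordinal} {α : Ordinal} (h : α ∈ dIcard n X) :
    0 < ell^[n + 1] α := by
  by_contra h0
  have h0' : ell^[n + 1] α = 0 := by simpa using h0
  obtain ⟨y, hy, hne⟩ := dIcard_exists h (icard_isolated n α h0') rfl
  exact hne hy.1

theorem mem_dIcard_of {n : ℕ} (hn : 0 < n) {X : Set Ordinal} {α δ q : Ordinal}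
    (hα : 0 < ell^[n + 1] α) (hδ : δ < α) (hq : q < ell α)
    (hX : ∀ η, δ < η → η < α → q ≤ ell η → η ∈ X) : α ∈ dIcard n X := by
  obtain ⟨G, hG, h1, h2⟩ := exists_filter n α hα
  have hle : G ≤ @nhds _ (icard n) α := by
    rw [icard, TopologicalSpace.nhds_generateFrom]
    refine le_iInf₂ fun U hU => ?_
    rw [le_principal_iff]
    obtain ⟨hαU, hU | ⟨m, hm1, hm2, β, rfl⟩⟩ := hU
    · have hU' : IsOpen U := hU
      obtain ⟨l, hl, hs⟩ := exists_Ioc_subset_of_mem_nhds (hU'.mem_nhds hαU) ⟨δ, hδ⟩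
      filter_upwards [h1, h2 0 (Nat.zero_le _) l hl] with x hx1 hx2
      exact hs ⟨hx2, hx1.le⟩
    · exact h2 m hm2 β hαU
  refine (@accPt_iff_nhds _ (icard n) _ _).2 fun U hU => ?_
  have hGU : U ∈ G := hle hU
  have hev : ∀ᶠ η in G, η ∈ U ∧ η < α ∧ δ < η ∧ q < ell η := by
    filter_upwards [hGU, h1, h2 0 (Nat.zero_le _) δ hδ, h2 1 hn q hq] with x a1 a2 a3 a4
    exact ⟨a1, a2, a3, a4⟩
  obtain ⟨η, a1, a2, a3, a4⟩ := hev.exists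
  exact ⟨η, ⟨a1, hX η a3 a2 a4.le⟩, a2.ne⟩

/-- If `X ∈ H₀(Ω)` and `n > 0`, then `d_n(X) ∩ Ω ∈ H_n(Ω)`. -/
theorem dn_of_H0_mem_Hn (Ω : Ordinal) (n : ℕ) (hn : 0 < n)
    (X : Set Ordinal) (hX : X ∈ H0 Ω) :
    dIcard n X ∩ Set.Iio Ω ∈ Hn n Ω := by
  obtain ⟨k, rfl⟩ : ∃ k, n = k + 1 := ⟨n - 1, by omega⟩
  have main : dIcard (k + 1) X ∩ Set.Iio Ω =
      (E0 X ∩ Set.Iio Ω) ∩ {α | α < Ω ∧ ell α ∈ {α | α < Ω ∧ 0 < ell^[k + 1] α}} := by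
    have key : ∀ α < Ω, 0 < ell^[k + 1 + 1] α →
        ∃ δ q lam : Ordinal, UPWith X α δ (ω ^ q) lam := by
      intro α hα hpos
      have h2 : 0 < ell (ell α) := by
        rw [pos_iff_ne_zero]
        rw [Function.iterate_succ_apply, Function.iterate_succ_apply] at hpos
        cases k with
        | zero => exact hpos.ne'
        | succ k => exact iter_pos_ne hpos
      have hl : Order.IsSuccLimit α := ell_pos_iff.1 (h2.trans_le (ell_le _))
      rcases (up_inter_iff.1 (hX.2 α hα.le hl)).cases with ⟨δ, π, h⟩ | ⟨δ, q, ν, _, h⟩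
      · exfalso
        have e := h.2.2.2.1
        rw [mul_omega0_eq_opow h.2.1] at e
        rw [e, ell_add _ (opow_ne_zero _ omega0_ne_zero), ell_opow, ell_pos_iff] at h2
        exact Order.not_isSuccLimit_succ _ h2
      · exact ⟨δ, q, _, h⟩
    ext α
    simp only [Set.mem_inter_iff, Set.mem_Iio, Set.mem_ofPred_eq]
    constructor
    · rintro ⟨hd, hα⟩
      have hpos := dIcard_iter_pos hd
      obtain ⟨δ, q, lam, h⟩ := key α hα hpos
      refine ⟨⟨?_, hα⟩, hα, (ell_le α).trans_lt hα, hpos⟩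
      have o1 := icard_isOpen_of_isOpen (k + 1) (isOpen_Ioc_ord δ α)
      have o2 : IsOpen[icard (k + 1)] {α | q < ell^[1] α} :=
        icard_isOpen_lt le_rfl (by omega) q
      obtain ⟨y, ⟨⟨⟨y1, y2⟩, y3⟩, y4⟩, y5⟩ := dIcard_exists hd
        ((icard (k + 1)).isOpen_inter _ _ o1 o2) ⟨⟨h.1, le_rfl⟩, h.lt_ell⟩
      rw [h.mem_E0_iff]
      exact (h.mem_iff_of_le_ell y1 (lt_of_le_of_ne y2 y5) (le_of_lt y3)).1 y4
    · rintro ⟨⟨hE, hα⟩, _, _, hpos⟩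
      refine ⟨?_, hα⟩
      obtain ⟨δ, q, lam, h⟩ := key α hα hpos
      have hδ := h.mem_E0_iff.1 hE
      exact mem_dIcard_of hn hpos h.1 h.lt_ell
        fun η h1 h2 h3 => (h.mem_iff_of_le_ell h1 h2 h3).2 hδ
  refine ⟨{dIcard (k + 1) X ∩ Set.Iio Ω}, ?_, by simp⟩
  rw [Finset.coe_singleton, Set.singleton_subset_iff, main]
  exact ⟨_, E0_mem_H0 hX, _, iter_mem_Vn Ω k, rfl⟩
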